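/- arXiv:2508.09642 — 5 statements merged into one kernel-verified Lean document; each statement's English description precedes it below -/
import Mathlib

section
/- Let F be a field, let L be a finite-dimensional Lie algebra over F, and suppose that L is an ideal of a (possibly infinite-dimensional) Lie algebra H' over F satisfying [H',H'] = L. Then there exists a finite-dimensional Lie subalgebra H of H' such that [H,H] = L. -/
/-- If a finite-dimensional Lie algebra `L` (over a field `F`) is an ideal of a possibly
infinite-dimensional Lie algebra `H'` with `[H',H'] = L`, then there is a finite-dimensional
Lie subalgebra `K` of `H'` whose derived algebra (the span of all brackets of elements of `K`)
is again `L`. -/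
theorem derived_algebra_of_finiteDimensional_witness
    (F : Type*) [Field F] (H' : Type*) [LieRing H'] [LieAlgebra F H']
    (L : LieIdeal F H') [FiniteDimensional F L]
    (hL : LieAlgebra.derivedSeries F H' 1 = L) :
    ∃ K : LieSubalgebra F H', FiniteDimensional F K ∧
      Submodule.span F {z : H' | ∃ x ∈ K, ∃ y ∈ K, ⁅x, y⁆ = z} =
        (L : Submodule F H') := by
  have hspan : Submodule.span F {z : H' | ∃ x y : H', ⁅x, y⁆ = z} = (L : Submodule F H') := by
    rw [← hL, LieAlgebra.derivedSeries_def, LieAlgebra.derivedSeriesOfIdeal_succ,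
      LieAlgebra.derivedSeriesOfIdeal_zero]
    refine Eq.trans ?_ (LieSubmodule.lieIdeal_oper_eq_linear_span' (R := F) (L := H') ⊤ ⊤).symm
    simp
  have hmem (x y : H') : ⁅x, y⁆ ∈ (L : Submodule F H') :=
    hspan ▸ Submodule.subset_span ⟨x, y, rfl⟩
  have hfg : (Submodule.span F {z : H' | ∃ x y : H', ⁅x, y⁆ = z}).FG := by
    rw [hspan]
    exact Module.Finite.iff_fg.mp ‹FiniteDimensional F L›
  obtain ⟨t, ht, hts⟩ := (Submodule.fg_span_iff_fg_span_finset_subset _).mp hfg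
  have hbracket : ∀ z ∈ t, ∃ x y : H', ⁅x, y⁆ = z := fun z hz => ht hz
  choose! a b hab using hbracket
  let V : Submodule F H' := Submodule.span F (a '' t ∪ b '' t)
  have hV : FiniteDimensional F V :=
    FiniteDimensional.span_of_finite F ((t.finite_toSet.image a).union (t.finite_toSet.image b))
  have hLfin : FiniteDimensional F (L : Submodule F H') := ‹FiniteDimensional F L›
  let K : LieSubalgebra F H' :=
    { (L : Submodule F H') ⊔ V with
      lie_mem' := fun {x y} _ _ => Submodule.mem_sup_left (hmem x y) }
  refine ⟨K, Submodule.finiteDimensional_sup (L : Submodule F H') V, le_antisymm ?_ ?_⟩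
  · rw [Submodule.span_le]
    rintro _ ⟨x, -, y, -, rfl⟩
    exact hmem x y
  · rw [← hspan, hts]
    refine Submodule.span_mono fun z hz => ⟨a z, ?_, b z, ?_, hab z hz⟩
    · exact Submodule.mem_sup_right (Submodule.subset_span (.inl ⟨z, hz, rfl⟩))
    · exact Submodule.mem_sup_right (Submodule.subset_span (.inr ⟨z, hz, rfl⟩))
end

section
/- Let L be a finite-dimensional Lie algebra over a field F which is a derived algebra, i.e., there exists a finite-dimensional Lie algebra H over F with [H,H] isomorphic to L as a Lie algebra. Then every one-dimensional characteristic ideal I of L (an ideal with D(I) ⊆ I for every derivation D of L) is contained in the centre Z(L) of L. -/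
universe u

/-- `L` is a *derived algebra* over `F` if it is isomorphic to the derived
subalgebra `[H,H]` of some finite-dimensional Lie algebra `H` over `F`. -/
def IsDerivedAlgebra (F : Type*) (L : Type*) [Field F] [LieRing L] [LieAlgebra F L] : Prop :=
  ∃ (H : Type u) (_ : LieRing H) (_ : LieAlgebra F H) (_ : Module.Finite F H),
    Nonempty (↥(LieAlgebra.derivedSeries F H 1) ≃ₗ⁅F⁆ L)

/-- Every element of `H` induces a derivation, by restricting its adjoint action, on any Lie
algebra isomorphic to an ideal of `H`. -/
def LieIdeal.derivationOfEquiv {F H L : Type*} [CommRing F] [LieRing H] [LieAlgebra F H]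
    [LieRing L] [LieAlgebra F L] {K : LieIdeal F H} (e : K ≃ₗ⁅F⁆ L) (h : H) :
    LieDerivation F L L where
  toLinearMap := e.toLinearEquiv.toLinearMap ∘ₗ LieModule.toEnd F H K h ∘ₗ
    e.symm.toLinearEquiv.toLinearMap
  leibniz' a b := by
    obtain ⟨a, rfl⟩ := e.surjective a
    obtain ⟨b, rfl⟩ := e.surjective b
    change e ⁅h, e.symm ⁅e a, e b⁆⁆ =
      ⁅e a, e ⁅h, e.symm (e b)⁆⁆ - ⁅e b, e ⁅h, e.symm (e a)⁆⁆
    rw [← LieEquiv.map_lie, e.symm_apply_apply, e.symm_apply_apply, e.symm_apply_apply,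
      ← LieEquiv.map_lie, ← LieEquiv.map_lie, ← map_sub]
    congr 1
    ext
    simp only [LieSubmodule.coe_bracket, LieSubmodule.coe_sub, LieIdeal.coe_bracket_of_module]
    rw [leibniz_lie h (a : H) (b : H), ← lie_skew (b : H) ⁅h, (a : H)⁆]
    abel

/-- If every element of `H` acts on `m` by a scalar, then the derived subalgebra annihilates `m`. -/
theorem LieAlgebra.lie_eq_zero_of_mem_derivedSeries_one {F H M : Type*} [CommRing F] [LieRing H]
    [LieAlgebra F H] [AddCommGroup M] [Module F M] [LieRingModule H M] [LieModule F H M] {m : M}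
    (hm : ∀ h : H, ∃ c : F, ⁅h, m⁆ = c • m) {k : H} (hk : k ∈ LieAlgebra.derivedSeries F H 1) :
    ⁅k, m⁆ = 0 := by
  have hk' : k ∈ (⁅(⊤ : LieIdeal F H), (⊤ : LieIdeal F H)⁆ : LieIdeal F H) := hk
  rw [← LieSubmodule.mem_toSubmodule, LieSubmodule.lieIdeal_oper_eq_linear_span'] at hk'
  clear hk
  induction hk' using Submodule.span_induction with
  | mem k h =>
    obtain ⟨a, -, b, -, rfl⟩ := h
    obtain ⟨c, hc⟩ := hm a
    obtain ⟨d, hd⟩ := hm b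
    rw [lie_lie, hd, lie_smul, hc, lie_smul, hd, smul_comm, sub_self]
  | zero => exact zero_lie m
  | add x y _ _ hx hy => rw [add_lie, hx, hy, add_zero]
  | smul c x _ hx => rw [smul_lie, hx, smul_zero]

/-- If a finite-dimensional Lie algebra `L` is a derived algebra, then every one-dimensional
characteristic ideal of `L` is contained in the centre of `L`. -/
theorem one_dimensional_characteristic_ideal_le_center
    (F L : Type*) [Field F] [LieRing L] [LieAlgebra F L] [FiniteDimensional F L]
    (hL : IsDerivedAlgebra F L)
    (I : LieIdeal F L)
    (hchar : ∀ D : LieDerivation F L L, ∀ x ∈ I, D x ∈ I)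
    (hdim : Module.finrank F I = 1) :
    I ≤ LieAlgebra.center F L := by
  obtain ⟨H, _, _, _, ⟨e⟩⟩ := hL
  intro x hx
  have hscalar (h : H) : ∃ c : F, ⁅h, e.symm x⁆ = c • e.symm x := by
    have hD : e ⁅h, e.symm x⁆ ∈ I := hchar (LieIdeal.derivationOfEquiv e h) x hx
    by_cases hx0 : x = 0
    · exact ⟨0, by simp [hx0]⟩
    obtain ⟨c, hc⟩ := exists_smul_eq_of_finrank_eq_one hdim
      (x := (⟨x, hx⟩ : I)) (by simpa using hx0) ⟨_, hD⟩
    refine ⟨c, e.injective ?_⟩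
    change e ⁅h, e.symm x⁆ = e (c • e.symm x)
    rw [map_smul, e.apply_symm_apply]
    exact (congrArg Subtype.val hc).symm
  rw [LieModule.mem_maxTrivSubmodule]
  intro y
  obtain ⟨k, rfl⟩ := e.surjective y
  have hk : ⁅k, e.symm x⁆ = 0 :=
    LieAlgebra.lie_eq_zero_of_mem_derivedSeries_one hscalar k.2
  change ⁅e k, x⁆ = 0
  rw [← e.apply_symm_apply x, ← LieEquiv.map_lie, hk, map_zero]
end

section
/- Let L be a finite-dimensional Lie algebra over a field F which is a derived algebra, i.e., there exists a finite-dimensional Lie algebra H over F with [H,H] isomorphic to L as a Lie algebra. Then the image of the adjoint representation ad : L → Der(L), x ↦ ad x, is contained in the derived subalgebra [Der(L), Der(L)] of the Lie algebra Der(L) of derivations of L. -/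
universe u

/-- The adjoint action of a Lie algebra `H` on an ideal `I`, transported along an isomorphism
`I ≃ L`, as a homomorphism from `H` to the derivations of `L`. -/
def LieIdeal.toDerivation {R H L : Type*} [CommRing R] [LieRing H] [LieAlgebra R H]
    [LieRing L] [LieAlgebra R L] (I : LieIdeal R H) (e : I ≃ₗ⁅R⁆ L) :
    H →ₗ⁅R⁆ LieDerivation R L L where
  toFun h :=
    { toLinearMap := (e : I →ₗ[R] L) ∘ₗ LieModule.toEnd R H I h ∘ₗ (e.symm : L →ₗ[R] I)
      leibniz' := fun a b => by
        obtain ⟨a, rfl⟩ := e.surjective a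
        obtain ⟨b, rfl⟩ := e.surjective b
        change e ⁅h, e.symm ⁅e a, e b⁆⁆ =
          ⁅e a, e ⁅h, e.symm (e b)⁆⁆ - ⁅e b, e ⁅h, e.symm (e a)⁆⁆
        simp only [← LieEquiv.map_lie, LieEquiv.symm_apply_apply, ← map_sub]
        congr 1
        apply Subtype.ext
        change ⁅h, ⁅(a : H), (b : H)⁆⁆ = ⁅(a : H), ⁅h, (b : H)⁆⁆ - ⁅(b : H), ⁅h, (a : H)⁆⁆
        rw [leibniz_lie h, ← lie_skew (b : H) ⁅h, (a : H)⁆]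
        abel }
  map_add' x y := by
    ext a
    simp
  map_smul' c x := by
    ext a
    simp
  map_lie' := by
    intro x y
    ext a
    simp

theorem LieIdeal.toDerivation_apply {R H L : Type*} [CommRing R] [LieRing H] [LieAlgebra R H]
    [LieRing L] [LieAlgebra R L] (I : LieIdeal R H) (e : I ≃ₗ⁅R⁆ L) (h : H) (a : L) :
    I.toDerivation e h a = e ⁅h, e.symm a⁆ :=
  rfl

/-- The action of an element of the ideal is the adjoint action of the corresponding element. -/
theorem LieIdeal.toDerivation_coe_symm {R H L : Type*} [CommRing R] [LieRing H] [LieAlgebra R H]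
    [LieRing L] [LieAlgebra R L] (I : LieIdeal R H) (e : I ≃ₗ⁅R⁆ L) (x : L) :
    I.toDerivation e (e.symm x : H) = LieDerivation.ad R L x := by
  ext a
  rw [LieIdeal.toDerivation_apply, LieDerivation.ad_apply_apply]
  apply e.symm.injective
  apply Subtype.ext
  simp

/-- If a finite-dimensional Lie algebra `L` is a derived algebra, then the image of the
adjoint representation `ad : L → Der(L)` is contained in the derived subalgebra
`[Der(L), Der(L)]` of the Lie algebra of derivations of `L`. -/
theorem ad_mem_derived_of_isDerivedAlgebra
    (F L : Type*) [Field F] [LieRing L] [LieAlgebra F L] [FiniteDimensional F L]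
    (hL : IsDerivedAlgebra F L) :
    ∀ x : L, LieDerivation.ad F L x ∈ LieAlgebra.derivedSeries F (LieDerivation F L L) 1 := by
  obtain ⟨H, _, _, _, ⟨e⟩⟩ := hL
  intro x
  rw [← LieIdeal.toDerivation_coe_symm _ e x]
  exact LieIdeal.derivedSeries_map_le 1
    (LieIdeal.mem_map (f := LieIdeal.toDerivation _ e) (e.symm x).property)
end

section
/- Let L be a finite-dimensional Lie algebra over a field F of characteristic zero, and let B be an ideal of L of codimension one in L. Suppose B decomposes as B = Rad(B) ⊕ S, where S is a semisimple ideal of B and Rad(B) is the radical of B, with [Rad(B), S] = 0 and Rad(B) ∩ S = 0. Then S is an ideal of L and L = Rad(L) ⊕ S, i.e., L = Rad(L) + S, Rad(L) ∩ S = 0 and [Rad(L), S] = 0, where Rad(L) is the radical of L. -/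
/-- A finite-dimensional Lie algebra over a field with nondegenerate Killing form is perfect. -/
lemma LieAlgebra.IsKilling.lie_top_top (K L : Type*) [Field K] [LieRing L] [LieAlgebra K L]
    [FiniteDimensional K L] [LieAlgebra.IsKilling K L] :
    ⁅(⊤ : LieIdeal K L), (⊤ : LieIdeal K L)⁆ = ⊤ := by
  have hcompl := LieIdeal.isCompl_killingCompl ⁅(⊤ : LieIdeal K L), (⊤ : LieIdeal K L)⁆
  set J := LieIdeal.killingCompl K L ⁅(⊤ : LieIdeal K L), (⊤ : LieIdeal K L)⁆
  have hJ : J = ⊥ := by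
    have : IsLieAbelian J := ⟨fun x y ↦ ?_⟩
    · exact LieAlgebra.IsKilling.ideal_eq_bot_of_isLieAbelian J
    have hmem : ⁅(x : L), (y : L)⁆ ∈ ⁅(⊤ : LieIdeal K L), (⊤ : LieIdeal K L)⁆ ⊓ J :=
      ⟨LieSubmodule.lie_mem_lie (LieSubmodule.mem_top _) (LieSubmodule.mem_top _),
        J.lie_mem y.2⟩
    rw [hcompl.inf_eq_bot, LieSubmodule.mem_bot] at hmem
    exact Subtype.ext hmem
  simpa [hJ] using hcompl.sup_eq_top

/-- An ideal with nondegenerate Killing form, together with its centralizer, spans the whole Lie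
algebra. -/
lemma LieIdeal.exists_mem_sub_lie_eq_zero {K L : Type*} [Field K] [LieRing L] [LieAlgebra K L]
    (I : LieIdeal K L) [FiniteDimensional K I] [LieAlgebra.IsKilling K I] (x : L) :
    ∃ s ∈ I, ∀ t ∈ I, ⁅x - s, t⁆ = 0 := by
  let D : LieDerivation K I I :=
    { toLinearMap := LieModule.toEnd K L I x
      leibniz' := fun a b ↦ by
        apply Subtype.ext
        change ⁅x, ⁅(a : L), (b : L)⁆⁆ = ⁅(a : L), ⁅x, (b : L)⁆⁆ - ⁅(b : L), ⁅x, (a : L)⁆⁆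
        rw [leibniz_lie, ← lie_skew (b : L), sub_neg_eq_add, add_comm] }
  obtain ⟨s, hs⟩ := LieDerivation.IsKilling.exists_eq_ad D
  refine ⟨s, s.2, fun t ht ↦ ?_⟩
  have h : ⁅s, (⟨t, ht⟩ : I)⁆ = D ⟨t, ht⟩ := by
    rw [← hs, LieDerivation.ad_apply_apply]
  have h' : ⁅(s : L), t⁆ = ⁅x, t⁆ := congrArg Subtype.val h
  rw [sub_lie, h', sub_self]

/-- An ideal of an ideal which is perfect is an ideal of the ambient Lie algebra. -/
lemma LieIdeal.lie_mem_map_subtype_of_perfect {R L : Type*} [CommRing R] [LieRing L]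
    [LieAlgebra R L] (B : LieIdeal R L) (S : LieIdeal R B)
    (hS : ⁅(⊤ : LieIdeal R S), (⊤ : LieIdeal R S)⁆ = ⊤) (x : L) {s : L}
    (hs : s ∈ (S : Submodule R B).map (B : Submodule R L).subtype) :
    ⁅x, s⁆ ∈ (S : Submodule R B).map (B : Submodule R L).subtype := by
  obtain ⟨b, hb, rfl⟩ := hs
  suffices H : ∀ c : S, ⁅x, ((c : B) : L)⁆ ∈
      (S : Submodule R B).map (B : Submodule R L).subtype from H ⟨b, hb⟩
  intro c
  have hc : c ∈ (⁅(⊤ : LieIdeal R S), (⊤ : LieIdeal R S)⁆ : LieIdeal R S).toSubmodule := by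
    rw [hS]; trivial
  rw [LieSubmodule.lieIdeal_oper_eq_linear_span'] at hc
  induction hc using Submodule.span_induction with
  | mem c h =>
    obtain ⟨u, -, v, -, rfl⟩ := h
    let xu : B := ⟨⁅x, ((u : B) : L)⁆, B.lie_mem u.1.2⟩
    let xv : B := ⟨⁅x, ((v : B) : L)⁆, B.lie_mem v.1.2⟩
    refine ⟨⁅xu, (v : B)⁆ + ⁅(u : B), xv⁆,
      S.add_mem (S.lie_mem v.2) (lie_mem_left R B S _ _ u.2), ?_⟩
    exact (leibniz_lie x ((u : B) : L) ((v : B) : L)).symm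
  | zero => simp
  | add c d _ _ hc hd => simpa using add_mem hc hd
  | smul r c _ hc => simpa using Submodule.smul_mem _ r hc

/-- An ideal of codimension one contains all brackets. -/
lemma LieIdeal.lie_mem_of_finrank_add_one_eq {K L : Type*} [Field K] [LieRing L] [LieAlgebra K L]
    [FiniteDimensional K L] (B : LieIdeal K L)
    (h : Module.finrank K B + 1 = Module.finrank K L) (x y : L) : ⁅x, y⁆ ∈ B := by
  have hq : Module.finrank K (L ⧸ (B : Submodule K L)) = 1 := by
    have := Submodule.finrank_quotient_add_finrank (B : Submodule K L)
    change _ + Module.finrank K B = _ at this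
    omega
  obtain ⟨v, -, hv⟩ := finrank_eq_one_iff'.mp hq
  obtain ⟨z, rfl⟩ := Submodule.Quotient.mk_surjective _ v
  have key : ∀ w : L, ∃ c : K, w - c • z ∈ B := fun w ↦ by
    obtain ⟨c, hc⟩ := hv (Submodule.Quotient.mk w)
    exact ⟨c, (Submodule.Quotient.eq _).mp hc.symm⟩
  obtain ⟨a, ha⟩ := key x
  obtain ⟨b, hb⟩ := key y
  have hxy : ⁅x, y⁆ = ⁅x - a • z, y⁆ + a • ⁅z, y - b • z⁆ := by simp
  rw [hxy]
  exact B.add_mem (lie_mem_left K L B _ _ ha) (B.smul_mem a (B.lie_mem hb))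

/-- The centralizer of an ideal of a Lie algebra, as an ideal. -/
def LieIdeal.centralizerIdeal {R L : Type*} [CommRing R] [LieRing L] [LieAlgebra R L]
    (I : LieIdeal R L) : LieIdeal R L where
  carrier := {x | ∀ t ∈ I, ⁅x, t⁆ = 0}
  zero_mem' := by simp
  add_mem' := fun ha hb t ht ↦ by rw [add_lie, ha t ht, hb t ht, add_zero]
  smul_mem' := fun c a ha t ht ↦ by rw [smul_lie, ha t ht, smul_zero]
  lie_mem := fun {x a} ha t ht ↦ by
    rw [lie_lie, ha t ht, ha _ (I.lie_mem ht), lie_zero, sub_zero]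

/-- An ideal whose brackets lie in a solvable ideal is solvable. -/
lemma LieIdeal.isSolvable_of_lie_le {R L : Type*} [CommRing R] [LieRing L] [LieAlgebra R L]
    {C I : LieIdeal R L} [LieAlgebra.IsSolvable I] (h : ⁅C, C⁆ ≤ I) :
    LieAlgebra.IsSolvable C := by
  obtain ⟨k, hk⟩ := LieAlgebra.IsSolvable.solvable R I
  rw [LieIdeal.derivedSeries_eq_bot_iff] at hk
  refine LieAlgebra.IsSolvable.mk (R := R) (k := k + 1) ?_
  rw [LieIdeal.derivedSeries_eq_bot_iff, LieAlgebra.derivedSeriesOfIdeal_add, eq_bot_iff, ← hk]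
  exact LieAlgebra.derivedSeriesOfIdeal_mono (by simpa using h) k

open LieAlgebra in
/-- (Characteristic zero.) If `B` is a codimension-one ideal of `L` decomposing as
`B = Rad(B) ⊕ S` with `S` a semisimple ideal of `B`, then (the image in `L` of) `S` is an
ideal of `L` and `L = Rad(L) ⊕ S`. -/
theorem codim_one_ideal_semisimple_decomposition
    (F L : Type*) [Field F] [CharZero F] [LieRing L] [LieAlgebra F L] [FiniteDimensional F L]
    (B : LieIdeal F L) (hcodim : Module.finrank F ↥B + 1 = Module.finrank F L)
    (S : LieIdeal F ↥B)
    (hss : LieAlgebra.radical F ↥S = ⊥)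
    (hsum : LieAlgebra.radical F ↥B ⊔ S = ⊤)
    (hint : LieAlgebra.radical F ↥B ⊓ S = ⊥)
    (hcomm : ∀ r ∈ LieAlgebra.radical F ↥B, ∀ s ∈ S, ⁅r, s⁆ = 0) :
    (∀ x : L, ∀ s ∈ (S : Submodule F ↥B).map (B : Submodule F L).subtype,
        ⁅x, s⁆ ∈ (S : Submodule F ↥B).map (B : Submodule F L).subtype) ∧
    (LieAlgebra.radical F L : Submodule F L) ⊔
        (S : Submodule F ↥B).map (B : Submodule F L).subtype = ⊤ ∧
    (LieAlgebra.radical F L : Submodule F L) ⊓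
        (S : Submodule F ↥B).map (B : Submodule F L).subtype = ⊥ ∧
    (∀ r ∈ LieAlgebra.radical F L, ∀ s ∈ (S : Submodule F ↥B).map (B : Submodule F L).subtype,
        ⁅r, s⁆ = 0) := by
  have : LieAlgebra.HasTrivialRadical F S := ⟨hss⟩
  have hideal : ∀ x : L, ∀ s ∈ (S : Submodule F ↥B).map (B : Submodule F L).subtype,
      ⁅x, s⁆ ∈ (S : Submodule F ↥B).map (B : Submodule F L).subtype := fun x s hs ↦
    LieIdeal.lie_mem_map_subtype_of_perfect B S (LieAlgebra.IsKilling.lie_top_top F S) x hs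
  let T : LieIdeal F L :=
    { (S : Submodule F ↥B).map (B : Submodule F L).subtype with
      lie_mem := fun {x s} hs ↦ hideal x s hs }
  have hTmem : ∀ b : B, (b : L) ∈ T → b ∈ S := by
    rintro b ⟨c, hc, hcb⟩
    rwa [← Subtype.ext hcb]
  let f : S →ₗ⁅F⁆ T :=
    { toFun := fun s ↦ ⟨((s : B) : L), (s : B), s.2, rfl⟩
      map_add' := fun _ _ ↦ rfl
      map_smul' := fun _ _ ↦ rfl
      map_lie' := rfl }
  have hf : Function.Bijective f := by
    refine ⟨fun a b h ↦ Subtype.ext (Subtype.ext ?_), ?_⟩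
    · exact congrArg (fun z : T ↦ (z : L)) h
    rintro ⟨_, s, hs, rfl⟩
    exact ⟨⟨s, hs⟩, rfl⟩
  have : LieAlgebra.IsKilling F T := (LieEquiv.ofBijective f hf).isKilling
  have hCT : ∀ x ∈ T.centralizerIdeal, x ∈ T → x = 0 := fun x hx hxT ↦ by
    have h : (⟨x, hxT⟩ : T) ∈ LieAlgebra.center F T := fun t ↦ by
      apply Subtype.ext
      change ⁅(t : L), x⁆ = 0
      rw [← lie_skew, hx t t.2, neg_zero]
    rw [LieAlgebra.center_eq_bot, LieSubmodule.mem_bot] at h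
    exact congrArg Subtype.val h
  have hCB : ∀ b : B, (b : L) ∈ T.centralizerIdeal → b ∈ radical F B := fun b hb ↦ by
    have hb' : b ∈ radical F B ⊔ S := hsum ▸ LieSubmodule.mem_top b
    obtain ⟨r, hr, s, hs, rfl⟩ := (LieSubmodule.mem_sup _ _ _).mp hb'
    have hsC : (s : L) ∈ T.centralizerIdeal := by
      rintro _ ⟨t, ht, rfl⟩
      have h1 : ⁅((r + s : B) : L), (t : L)⁆ = 0 := hb t ⟨t, ht, rfl⟩
      have h2 : ⁅(r : L), (t : L)⁆ = 0 := congrArg Subtype.val (hcomm r hr t ht)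
      change ⁅(r : L) + (s : L), (t : L)⁆ = 0 at h1
      rwa [add_lie, h2, zero_add] at h1
    have hs0 : s = 0 := Subtype.ext (hCT s hsC ⟨s, hs, rfl⟩)
    rwa [hs0, add_zero]
  have hCBsolv : IsSolvable ↥(T.centralizerIdeal ⊓ B) := by
    let g : ↥(T.centralizerIdeal ⊓ B) →ₗ⁅F⁆ radical F B :=
      { toFun := fun x ↦ ⟨⟨x, x.2.2⟩, hCB _ x.2.1⟩
        map_add' := fun _ _ ↦ rfl
        map_smul' := fun _ _ ↦ rfl
        map_lie' := rfl }
    refine Function.Injective.lieAlgebra_isSolvable (f := g) fun a b h ↦ Subtype.ext ?_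
    exact congrArg (fun z : radical F B ↦ ((z : B) : L)) h
  have hCsolv : IsSolvable ↥T.centralizerIdeal :=
    LieIdeal.isSolvable_of_lie_le (I := T.centralizerIdeal ⊓ B) <|
      (LieSubmodule.lie_le_iff ..).mpr fun x _ y hy ↦
        ⟨T.centralizerIdeal.lie_mem hy, B.lie_mem_of_finrank_add_one_eq hcodim x y⟩
  have hCle : T.centralizerIdeal ≤ radical F L :=
    (LieIdeal.solvable_iff_le_radical F L _).mp hCsolv
  have hinf : ∀ x ∈ radical F L, x ∈ T → x = 0 := fun x hx hxT ↦ by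
    have hsolv : IsSolvable ↥((radical F L).comap T.incl) := by
      let g : ↥((radical F L).comap T.incl) →ₗ⁅F⁆ radical F L :=
        { toFun := fun x ↦ ⟨((x : T) : L), x.2⟩
          map_add' := fun _ _ ↦ rfl
          map_smul' := fun _ _ ↦ rfl
          map_lie' := rfl }
      refine Function.Injective.lieAlgebra_isSolvable (f := g) fun a b h ↦
        Subtype.ext (Subtype.ext ?_)
      exact congrArg (fun z : radical F L ↦ (z : L)) h
    have h : (⟨x, hxT⟩ : T) ∈ (radical F L).comap T.incl := hx
    rw [HasTrivialRadical.eq_bot_of_isSolvable ((radical F L).comap T.incl),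
      LieSubmodule.mem_bot] at h
    exact congrArg Subtype.val h
  refine ⟨hideal, ?_, ?_, ?_⟩
  · refine eq_top_iff.mpr fun x _ ↦ ?_
    obtain ⟨s, hs, hxs⟩ := T.exists_mem_sub_lie_eq_zero x
    exact Submodule.mem_sup.mpr ⟨x - s, hCle hxs, s, hs, sub_add_cancel x s⟩
  · exact (Submodule.eq_bot_iff _).mpr fun x hx ↦ hinf x hx.1 hx.2
  · exact fun r hr s hs ↦
      hinf _ (lie_mem_left F L (radical F L) _ _ hr) (hideal r s hs)
end

section
/- Let R be a nonzero commutative ring with identity. Then R is not a derived ring: there is no (associative) ring S such that R is isomorphic, as a non-unital ring, to the two-sided ideal of S generated by all commutators [a,b] = ab − ba with a, b ∈ S. -/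
/-- A two-sided ideal `I` with a ring isomorphism from a unital ring `R` has a central identity
element, so multiplication by it is a ring homomorphism onto `I ≃+* R`. -/
theorem TwoSidedIdeal.exists_nonUnitalRingHom_leftInverse {R S : Type*} [Ring R]
    [NonUnitalRing S] (I : TwoSidedIdeal S) (φ : R ≃+* ↥I) :
    ∃ f : S →ₙ+* R, ∀ x : ↥I, f x = φ.symm x := by
  have hl (x : S) (hx : x ∈ I) : (φ 1 : S) * x = x := by
    have h : φ 1 * ⟨x, hx⟩ = ⟨x, hx⟩ := φ.symm.injective (by simp)
    exact congrArg Subtype.val h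
  have hr (x : S) (hx : x ∈ I) : x * (φ 1 : S) = x := by
    have h : ⟨x, hx⟩ * φ 1 = ⟨x, hx⟩ := φ.symm.injective (by simp)
    exact congrArg Subtype.val h
  have hm (s : S) : (φ 1 : S) * s ∈ I := I.mul_mem_right _ _ (φ 1).2
  refine ⟨⟨⟨fun s => φ.symm ⟨(φ 1 : S) * s, hm s⟩, fun s t => ?_⟩, ?_, fun s t => ?_⟩,
    fun x => ?_⟩
  · rw [← map_mul]
    congr 1
    apply Subtype.ext
    change (φ 1 : S) * (s * t) = (φ 1 : S) * s * ((φ 1 : S) * t)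
    rw [← mul_assoc, ← mul_assoc, hr _ (hm s)]
  · change φ.symm _ = 0
    rw [EmbeddingLike.map_eq_zero_iff]
    exact Subtype.ext (mul_zero _)
  · change φ.symm _ = φ.symm _ + φ.symm _
    rw [← map_add]
    congr 1
    exact Subtype.ext (mul_add _ _ _)
  · exact congrArg φ.symm (Subtype.ext (hl x x.2))

/-- A nonzero commutative ring with identity is not a derived ring: it is not isomorphic
(as a non-unital ring) to the two-sided ideal generated by all commutators `a*b - b*a`
of any associative ring `S`. -/
theorem commRing_not_derived_ring
    (R : Type*) [CommRing R] [Nontrivial R] :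
    ¬ ∃ (S : Type _) (_ : NonUnitalRing S),
        Nonempty (R ≃+* ↥(TwoSidedIdeal.span {z : S | ∃ a b : S, a * b - b * a = z})) := by
  rintro ⟨S, _, ⟨φ⟩⟩
  obtain ⟨f, hf⟩ := TwoSidedIdeal.exists_nonUnitalRingHom_leftInverse _ φ
  have h : (φ 1 : S) ∈ TwoSidedIdeal.ker f := by
    refine TwoSidedIdeal.mem_span_iff.mp (φ 1).2 _ ?_
    rintro _ ⟨a, b, rfl⟩
    simp [TwoSidedIdeal.mem_ker, mul_comm]
  rw [TwoSidedIdeal.mem_ker, hf, φ.symm_apply_apply] at h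
  exact one_ne_zero h
end
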